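/- Let 𝒜 be a nonempty alphabet and X ⊆ 𝒜^ℕ a subshift. Let Ω denote the closure in X_𝔽 of {ξ_x : x ∈ X}, and for g ∈ 𝔽 let Ω_g := {ξ ∈ Ω : g ∈ ξ}. Then for every g ∈ 𝔽 and every ξ ∈ Ω with g⁻¹ ∈ ξ, the left translate gξ := {gh : h ∈ ξ} belongs to Ω (and g ∈ gξ); moreover, the map ξ ↦ gξ is a homeomorphism from Ω_{g⁻¹} onto Ω_g whose inverse is ξ ↦ g⁻¹ξ. -/

import Mathlib

/-! Basic subshift vocabulary. -/

/-- Concatenation of a finite word with an infinite sequence. -/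
def wcat {A : Type*} (w : List A) (y : ℕ → A) : ℕ → A :=
  fun n => if h : n < w.length then w.get ⟨n, h⟩ else y (n - w.length)

/-- `w` occurs as a (finite) factor of the sequence `x`. -/
def IsFactor {A : Type*} (w : List A) (x : ℕ → A) : Prop :=
  ∃ n : ℕ, ∀ i : Fin w.length, x (n + i) = w.get i

/-- The subshift `X_F ⊆ A^ℕ` determined by a set `F` of forbidden words. -/
def subshift {A : Type*} (Forb : Set (List A)) : Set (ℕ → A) :=
  {x | ∀ w ∈ Forb, ¬ IsFactor w x}

/-- The language of a set of sequences: all finite words (including the empty word)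
occurring as factors of its elements. -/
def lang {A : Type*} (Xs : Set (ℕ → A)) : Set (List A) :=
  {w | w = [] ∨ ∃ x ∈ Xs, IsFactor w x}

/-- `C(α, β) = {βx ∈ X : αx ∈ X}`. -/
def Cab {A : Type*} (Xs : Set (ℕ → A)) (α β : List A) : Set (ℕ → A) :=
  {z | ∃ y : ℕ → A, z = wcat β y ∧ wcat β y ∈ Xs ∧ wcat α y ∈ Xs}

/-- The element of the free group on `A` determined by a word over `A`. -/
def fgw {A : Type*} (w : List A) : FreeGroup A := (w.map FreeGroup.of).prod

/-- `ξ_x = {g ∈ 𝔽 : g = βα⁻¹ for some α, β ∈ L_X with x ∈ C(α,β)}`. -/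
def xiSet {A : Type*} (Xs : Set (ℕ → A)) (x : ℕ → A) : Set (FreeGroup A) :=
  {g | ∃ α ∈ lang Xs, ∃ β ∈ lang Xs, g = fgw β * (fgw α)⁻¹ ∧ x ∈ Cab Xs α β}

/-- `α` and `β` do not end in the same letter, i.e. `αβ⁻¹` is in reduced form. -/
def NoCommonLast {A : Type*} (α β : List A) : Prop :=
  ∀ a : A, α.getLast? = some a → β.getLast? ≠ some a

open Classical in
/-- The characteristic function of `ξ_x`, viewed as a point of the product space
`{0,1}^𝔽` (with `{0,1}` discrete). -/
noncomputable def xiB {A : Type*} (Xs : Set (ℕ → A)) (x : ℕ → A) : FreeGroup A → Bool :=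
  fun g => if g ∈ xiSet Xs x then true else false

/-- `Ω`: the closure in `X_𝔽 ⊆ {0,1}^𝔽` of `{ξ_x : x ∈ X}`. -/
noncomputable def Omega {A : Type*} (Xs : Set (ℕ → A)) : Set (FreeGroup A → Bool) :=
  closure {ξ | ∃ x ∈ Xs, ξ = xiB Xs x}

section WordConcatenation

variable {A : Type*}

@[simp]
theorem wcat_nil (y : ℕ → A) : wcat [] y = y := by
  funext n
  simp [wcat]

@[simp]
theorem wcat_cons_zero (a : A) (w : List A) (y : ℕ → A) : wcat (a :: w) y 0 = a := by
  simp [wcat]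

@[simp]
theorem wcat_cons_succ (a : A) (w : List A) (y : ℕ → A) (n : ℕ) :
    wcat (a :: w) y (n + 1) = wcat w y n := by
  simp [wcat]

theorem wcat_cons_inj {a b : A} {v w : List A} {y z : ℕ → A} :
    wcat (a :: v) y = wcat (b :: w) z ↔ a = b ∧ wcat v y = wcat w z := by
  constructor
  · intro h
    exact ⟨by simpa using congrFun h 0, funext fun n => by simpa using congrFun h (n + 1)⟩
  · rintro ⟨rfl, h⟩
    funext n
    cases n with
    | zero => simp
    | succ n => simp [h]

theorem wcat_append (v w : List A) (y : ℕ → A) : wcat (v ++ w) y = wcat v (wcat w y) := by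
  induction v with
  | nil => simp
  | cons a v ih => exact wcat_cons_inj.2 ⟨rfl, ih⟩

/-- If `βy = δz` then one of the prefixes `β`, `δ` extends the other. -/
theorem wcat_eq_wcat {β δ : List A} {y z : ℕ → A} (h : wcat β y = wcat δ z) :
    (∃ ε, δ = β ++ ε ∧ y = wcat ε z) ∨ (∃ ε, β = δ ++ ε ∧ z = wcat ε y) := by
  induction β generalizing δ with
  | nil => exact .inl ⟨δ, rfl, by simpa using h⟩
  | cons a β ih =>
    cases δ with
    | nil => exact .inr ⟨a :: β, rfl, by simpa using h.symm⟩
    | cons b δ =>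
      obtain ⟨rfl, htail⟩ := wcat_cons_inj.1 h
      rcases ih htail with ⟨ε, rfl, hy⟩ | ⟨ε, rfl, hz⟩
      · exact .inl ⟨ε, rfl, hy⟩
      · exact .inr ⟨ε, rfl, hz⟩

theorem isFactor_wcat (w : List A) (y : ℕ → A) : IsFactor w (wcat w y) :=
  ⟨0, fun i => by simp [wcat]⟩

theorem fgw_append (v w : List A) : fgw (v ++ w) = fgw v * fgw w := by
  simp [fgw]

end WordConcatenation

section Translation

variable {A : Type*} {Xs : Set (ℕ → A)}

theorem mem_xiSet {x : ℕ → A} {g : FreeGroup A} :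
    g ∈ xiSet Xs x ↔ ∃ (α β : List A) (y : ℕ → A), g = fgw β * (fgw α)⁻¹ ∧
      x = wcat β y ∧ wcat β y ∈ Xs ∧ wcat α y ∈ Xs := by
  constructor
  · rintro ⟨α, -, β, -, hg, y, h⟩
    exact ⟨α, β, y, hg, h⟩
  · rintro ⟨α, β, y, hg, hx, hβ, hα⟩
    exact ⟨α, .inr ⟨_, hα, isFactor_wcat α y⟩, β, .inr ⟨_, hβ, isFactor_wcat β y⟩, hg,
      y, hx, hβ, hα⟩

theorem one_mem_xiSet {x : ℕ → A} (hx : x ∈ Xs) : (1 : FreeGroup A) ∈ xiSet Xs x :=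
  mem_xiSet.2 ⟨[], [], x, by simp, by simp, by simpa, by simpa⟩

theorem mul_mem_xiSet_wcat {α β : List A} {y : ℕ → A} (hα : wcat α y ∈ Xs) {h : FreeGroup A}
    (hh : h ∈ xiSet Xs (wcat β y)) : fgw α * (fgw β)⁻¹ * h ∈ xiSet Xs (wcat α y) := by
  obtain ⟨γ, δ, z, rfl, hx, -, hγ⟩ := mem_xiSet.1 hh
  rcases wcat_eq_wcat hx with ⟨ε, rfl, rfl⟩ | ⟨ε, rfl, rfl⟩
  · refine mem_xiSet.2 ⟨γ, α ++ ε, z, ?_, (wcat_append α ε z).symm, ?_, hγ⟩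
    · simp only [fgw_append]
      group
    · rwa [wcat_append]
  · refine mem_xiSet.2 ⟨γ ++ ε, α, y, ?_, rfl, hα, ?_⟩
    · simp only [fgw_append]
      group
    · rwa [wcat_append]

/-- Left translation by `g` sends `ξ_x` with `g⁻¹ ∈ ξ_x` to some `ξ_{x'}`. -/
theorem exists_xiSet_translate {x : ℕ → A} {g : FreeGroup A} (hg : g⁻¹ ∈ xiSet Xs x) :
    ∃ x' ∈ Xs, ∀ h, g⁻¹ * h ∈ xiSet Xs x ↔ h ∈ xiSet Xs x' := by
  obtain ⟨α, β, y, hginv, rfl, hβ, hα⟩ := mem_xiSet.1 hg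
  refine ⟨wcat α y, hα, fun h => ⟨fun hh => ?_, fun hh => ?_⟩⟩
  · have := mul_mem_xiSet_wcat hα hh
    rwa [← inv_inv (fgw α * (fgw β)⁻¹), mul_inv_rev, inv_inv, ← hginv, inv_inv,
      mul_inv_cancel_left] at this
  · rw [hginv]
    exact mul_mem_xiSet_wcat hβ hh

theorem xiB_eq_true {x : ℕ → A} {g : FreeGroup A} : xiB Xs x g = true ↔ g ∈ xiSet Xs x := by
  simp [xiB]

theorem isClopen_setOf_apply_eq_true {G : Type*} (g : G) :
    IsClopen {ξ : G → Bool | ξ g = true} :=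
  (isClopen_discrete {true}).preimage (continuous_apply g)

theorem apply_one_of_mem_Omega {ξ : FreeGroup A → Bool} (hξ : ξ ∈ Omega Xs) : ξ 1 = true := by
  refine closure_minimal ?_ (isClopen_setOf_apply_eq_true 1).isClosed hξ
  rintro _ ⟨x, hx, rfl⟩
  exact xiB_eq_true.2 (one_mem_xiSet hx)

theorem continuous_translate {G : Type*} [Mul G] (k : G) :
    Continuous fun (ξ : G → Bool) h => ξ (k * h) := by
  fun_prop

theorem translate_mem_Omega {ξ : FreeGroup A → Bool} {g : FreeGroup A} (hξ : ξ ∈ Omega Xs)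
    (hg : ξ g⁻¹ = true) : (fun h => ξ (g⁻¹ * h)) ∈ Omega Xs := by
  refine map_mem_closure (continuous_translate g⁻¹)
    ((isClopen_setOf_apply_eq_true g⁻¹).isOpen.inter_closure ⟨hg, hξ⟩) ?_
  rintro _ ⟨hx, x, -, rfl⟩
  obtain ⟨x', hx', h⟩ := exists_xiSet_translate (xiB_eq_true.1 hx)
  exact ⟨x', hx', funext fun k => Bool.eq_iff_iff.2 (by simpa only [xiB_eq_true] using h k)⟩

end Translation

/-- The partial action of `𝔽` on `Ω` by left translation: for `g ∈ 𝔽` and `ξ ∈ Ω` with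
`g⁻¹ ∈ ξ`, the left translate `gξ` lies in `Ω` and contains `g`; moreover `ξ ↦ gξ` is a
homeomorphism from `Ω_{g⁻¹}` onto `Ω_g`, with inverse `ξ ↦ g⁻¹ξ`. -/
theorem stmt_13 {A : Type*} [Nonempty A] (Forb : Set (List A)) (g : FreeGroup A) :
    (∀ ξ : FreeGroup A → Bool, ξ ∈ Omega (subshift Forb) → ξ g⁻¹ = true →
      (fun h => ξ (g⁻¹ * h)) ∈ Omega (subshift Forb) ∧ (fun h => ξ (g⁻¹ * h)) g = true) ∧
    ∃ e : {ξ : FreeGroup A → Bool // ξ ∈ Omega (subshift Forb) ∧ ξ g⁻¹ = true} ≃ₜ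
        {ξ : FreeGroup A → Bool // ξ ∈ Omega (subshift Forb) ∧ ξ g = true},
      (∀ ξ, ((e ξ : {ξ : FreeGroup A → Bool // ξ ∈ Omega (subshift Forb) ∧ ξ g = true}) :
          FreeGroup A → Bool) = fun h => (ξ : FreeGroup A → Bool) (g⁻¹ * h)) ∧
      (∀ ξ, ((e.symm ξ :
          {ξ : FreeGroup A → Bool // ξ ∈ Omega (subshift Forb) ∧ ξ g⁻¹ = true}) :
          FreeGroup A → Bool) = fun h => (ξ : FreeGroup A → Bool) (g * h)) := by
  have translate (k : FreeGroup A) (ξ : FreeGroup A → Bool) (hξ : ξ ∈ Omega (subshift Forb))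
      (hk : ξ k⁻¹ = true) : (fun h => ξ (k⁻¹ * h)) ∈ Omega (subshift Forb) ∧
        (fun h => ξ (k⁻¹ * h)) k = true :=
    ⟨translate_mem_Omega hξ hk, by simpa using apply_one_of_mem_Omega hξ⟩
  refine ⟨translate g, ⟨⟨⟨fun ξ => ⟨fun h => ξ.1 (g⁻¹ * h), translate g ξ.1 ξ.2.1 ξ.2.2⟩,
    fun ξ => ⟨fun h => ξ.1 (g * h), ?_⟩, ?_, ?_⟩, ?_, ?_⟩, fun _ => rfl, fun _ => rfl⟩⟩
  · simpa using translate g⁻¹ ξ.1 ξ.2.1 (by simpa using ξ.2.2)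
  · intro ξ
    simp
  · intro ξ
    simp
  · exact ((continuous_translate g⁻¹).comp continuous_subtype_val).subtype_mk _
  · exact ((continuous_translate g).comp continuous_subtype_val).subtype_mk _
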